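/- Assume u ∉ k (u is not a constant polynomial). Then for every L ∈ (ℕ →₀ k[t]) there exists a unique L̃ ∈ (ℕ →₀ k[t]) such that t divides L̃(i) in k[t] for every i ∈ ℕ, and L − δ10(L̃) is supported in {0} (i.e. (L − δ10(L̃))(i) = 0 for all i ≥ 1). (The unique normal-form reduction established in the proof of Lemma 2.2.4.) -/

import Mathlib

open Polynomial

/-- `T μ P = P(t+μ) − P(t)`, the difference operator of Section 2.2 of
Guccione–Guccione, "Hochschild homology of iterated skew polynomial rings". -/
noncomputable def Tdiff {k : Type*} [Field k] (μ : k) (P : k[X]) : k[X] :=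
  P.comp (X + C μ) - P


theorem Tdiff_add {k : Type*} [Field k] (μ : k) (P Q : k[X]) :
    Tdiff μ (P + Q) = Tdiff μ P + Tdiff μ Q := by
  simp only [Tdiff, add_comp]; ring

theorem Tdiff_C_mul {k : Type*} [Field k] (μ a : k) (P : k[X]) :
    Tdiff μ (C a * P) = C a * Tdiff μ P := by
  simp only [Tdiff, mul_comp, C_comp]; ring

/-- The difference operator as a linear map. -/
noncomputable def TdiffL {k : Type*} [Field k] (μ : k) : k[X] →ₗ[k] k[X] where
  toFun := Tdiff μ
  map_add' := Tdiff_add μ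
  map_smul' a P := by
    simp only [smul_eq_C_mul, Tdiff_C_mul, RingHom.id_apply]

theorem TdiffL_apply {k : Type*} [Field k] (μ : k) (P : k[X]) :
    TdiffL μ P = Tdiff μ P := rfl

theorem X_pow_mem_range {k : Type*} [Field k] [CharZero k] (lam : k) (hlam : lam ≠ 0) (n : ℕ) :
    (X ^ n : k[X]) ∈ LinearMap.range (TdiffL lam) := by
  induction n using Nat.strong_induction_on with
  | _ n ih =>
    have h1 : Tdiff lam (X ^ (n + 1)) =
        ∑ m ∈ Finset.range n, (lam ^ (n + 1 - m) * ((n + 1).choose m : k)) • (X ^ m : k[X])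
          + (lam * ((n : k) + 1)) • (X ^ n : k[X]) := by
      simp only [Tdiff, pow_comp, X_comp]
      rw [add_pow, Finset.sum_range_succ, Finset.sum_range_succ]
      simp [smul_eq_C_mul]
      refine congrArg₂ (· + ·) (Finset.sum_congr rfl (fun m _ => ?_)) ?_
      · ring
      · ring
    have hne : lam * ((n : k) + 1) ≠ 0 := mul_ne_zero hlam (by exact_mod_cast Nat.succ_ne_zero n)
    rw [← Submodule.smul_mem_iff _ hne, ← sub_eq_of_eq_add' h1]
    refine Submodule.sub_mem _ ⟨_, rfl⟩ (Submodule.sum_mem _ fun m hm => ?_)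
    exact Submodule.smul_mem _ _ (ih m (Finset.mem_range.1 hm))

theorem Tdiff_surj {k : Type*} [Field k] [CharZero k] (lam : k) (hlam : lam ≠ 0) (P : k[X]) :
    ∃ Q : k[X], X ∣ Q ∧ Tdiff lam Q = P := by
  have h : P ∈ LinearMap.range (TdiffL lam) := by
    rw [P.as_sum_range_C_mul_X_pow]
    refine Submodule.sum_mem _ fun m _ => ?_
    rw [← smul_eq_C_mul]
    exact Submodule.smul_mem _ _ (X_pow_mem_range lam hlam m)
  obtain ⟨Q, hQ⟩ := h
  refine ⟨Q - C (Q.coeff 0), ?_, ?_⟩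
  · simp [X_dvd_iff]
  · rw [← hQ, TdiffL_apply]; simp [Tdiff]

theorem Tdiff_inj {k : Type*} [Field k] [CharZero k] (lam : k) (hlam : lam ≠ 0) (P : k[X])
    (hX : X ∣ P) (hP : Tdiff lam P = 0) : P = 0 := by
  have hP' : P.comp (X + C lam) = P := sub_eq_zero.1 hP
  have h : ∀ n : ℕ, P.eval ((n : k) * lam) = 0 := by
    intro n
    induction n with
    | zero =>
      rw [X_dvd_iff, coeff_zero_eq_eval_zero] at hX
      simpa using hX
    | succ n ih =>
      rw [← hP', eval_comp] at ih
      rw [← ih]; congr 1; simp; ring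
  refine Polynomial.eq_zero_of_infinite_isRoot P ?_
  refine (Set.infinite_range_of_injective (f := fun n : ℕ => (n : k) * lam) ?_).mono ?_
  · intro a b hab
    exact_mod_cast mul_right_cancel₀ hlam hab
  · rintro _ ⟨n, rfl⟩
    exact h n

/-- The unique normal-form reduction from the proof of Lemma 2.2.4 of
Guccione–Guccione: if `u ∉ k`, every `L ∈ ⊕_{i≥0} k[t]·x^i y^i` admits a
unique `L̃` all of whose components are divisible by `t` such that
`L − δ₁₀(L̃)` is concentrated in degree `x⁰y⁰`. -/
theorem stmt11 {k : Type*} [Field k] [CharZero k] (lam : k) (hlam : lam ≠ 0)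
    (u : k[X]) (hu : ∀ c : k, u ≠ C c)
    (D : (ℕ →₀ k[X]) →ₗ[k] (ℕ →₀ k[X]))
    (hD : ∀ (j : ℕ) (Q : k[X]),
      D (Finsupp.single j Q) =
        -Finsupp.single (j + 1) (Tdiff lam Q) -
          Finsupp.single j (Q * Tdiff (((j : k) + 1) * lam) u)) :
    ∀ L : ℕ →₀ k[X], ∃! Lt : ℕ →₀ k[X],
      (∀ i : ℕ, X ∣ Lt i) ∧ ∀ i : ℕ, 1 ≤ i → (L - D Lt) i = 0 := by
  have key : ∀ (M : ℕ →₀ k[X]) (i : ℕ), D M (i + 1) =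
      - Tdiff lam (M i) - M (i + 1) * Tdiff (((i + 1 : ℕ) : k) * lam + lam) u := by
    intro M i
    induction M using Finsupp.induction_linear with
    | zero => simp [Tdiff]
    | add f g hf hg =>
      rw [map_add D, Finsupp.add_apply, hf, hg, Finsupp.add_apply, Finsupp.add_apply, Tdiff_add]
      ring
    | single j Q =>
      rw [hD]
      have h0 : Tdiff lam (0 : k[X]) = 0 := by simp [Tdiff]
      by_cases h1 : j = i
      · subst h1; simp
      · by_cases h2 : j = i + 1
        · subst h2; simp [h0, add_mul]
        · simp [Finsupp.single_apply, h1, h2, h0]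
  have ex1 : ∀ (n : ℕ) (P : k[X]), ∃ Lt : ℕ →₀ k[X],
      (∀ i : ℕ, X ∣ Lt i) ∧ ∀ i : ℕ, 1 ≤ i → (Finsupp.single n P - D Lt) i = 0 := by
    intro n
    induction n with
    | zero =>
      intro P
      refine ⟨0, by simp, fun i hi => ?_⟩
      have : 0 ≠ i := by omega
      simp [Finsupp.single_apply, this]
    | succ n ih =>
      intro P
      obtain ⟨Q, hQ, hT⟩ := Tdiff_surj lam hlam (-P)
      obtain ⟨L', h1, h2⟩ := ih (Q * Tdiff (((n : k) + 1) * lam) u)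
      refine ⟨Finsupp.single n Q + L', fun i => ?_, fun i hi => ?_⟩
      · rw [Finsupp.add_apply]
        refine dvd_add ?_ (h1 i)
        rw [Finsupp.single_apply]; split_ifs
        · exact hQ
        · exact dvd_zero _
      · rw [← h2 i hi, map_add, hD, hT, Finsupp.single_neg]
        congr 1; abel
  intro L
  have ex : ∃ Lt : ℕ →₀ k[X],
      (∀ i : ℕ, X ∣ Lt i) ∧ ∀ i : ℕ, 1 ≤ i → (L - D Lt) i = 0 := by
    induction L using Finsupp.induction_linear with
    | zero => exact ⟨0, by simp, by simp⟩
    | add f g hf hg =>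
      obtain ⟨a, ha, ha'⟩ := hf
      obtain ⟨b, hb, hb'⟩ := hg
      refine ⟨a + b, fun i => dvd_add (ha i) (hb i), fun i hi => ?_⟩
      rw [map_add, add_sub_add_comm, Finsupp.add_apply, ha' i hi, hb' i hi, add_zero]
    | single n P => exact ex1 n P
  obtain ⟨A, hA, hA'⟩ := ex
  refine ⟨A, ⟨hA, hA'⟩, ?_⟩
  rintro B ⟨hB, hB'⟩
  rw [← sub_eq_zero]
  have hM : ∀ i, X ∣ (B - A) i := fun i => dvd_sub (hB i) (hA i)
  have hM' : ∀ i, D (B - A) (i + 1) = 0 := by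
    intro i
    have e1 := hA' (i + 1) (by omega)
    have e2 := hB' (i + 1) (by omega)
    rw [Finsupp.sub_apply] at e1 e2
    rw [map_sub, Finsupp.sub_apply]
    linear_combination e1 - e2
  generalize B - A = M at hM hM'
  have step : ∀ i, M (i + 1) = 0 → M i = 0 := by
    intro i hi
    have := key M i
    rw [hM' i, hi, zero_mul, sub_zero] at this
    exact Tdiff_inj lam hlam _ (hM i) (neg_eq_zero.1 this.symm)
  have down : ∀ n i, M (i + n) = 0 → M i = 0 := by
    intro n
    induction n with
    | zero => intro i h; exact h
    | succ n ih => intro i h; exact ih i (step _ h)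
  ext1 i
  refine down (M.support.sup id + 1) i ?_
  by_contra hne
  have := Finset.le_sup (f := id) (Finsupp.mem_support_iff.2 hne)
  simp only [id] at this
  omega
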